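/- Let A_1, A_2 ⊂ ℤ² be full-dimensional finite configurations, and for j ≠ i suppose every edge of A_j is strongly parallel to some edge of A_i (i.e., ℰ′_j = ∅). Then Σ_{v ∈ Vert(A_i)} mmult(v) = 0, i.e., every vertex of A_i has mixed multiplicity zero. -/

import Mathlib

open scoped Pointwise
open MeasureTheory

noncomputable section

abbrev Pt : Type := ℤ × ℤ

def toR2 (p : Pt) : ℝ × ℝ := ((p.1 : ℝ), (p.2 : ℝ))

/-- Normalized lattice area (a primitive lattice triangle has area 1). -/
def narea (A : Finset Pt) : ℝ :=
  2 * (volume (convexHull ℝ (toR2 '' (A : Set Pt)))).toReal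

/-- A planar configuration is full-dimensional if its points are not collinear. -/
def FullDim (A : Finset Pt) : Prop := ¬ Collinear ℝ (toR2 '' (A : Set Pt))

/-- Mixed volume (mixed area) of the convex hulls of two configurations. -/
def mvol (A B : Finset Pt) : ℝ := (narea (A + B) - narea A - narea B) / 2

def IsVertex (A : Finset Pt) (v : Pt) : Prop :=
  v ∈ A ∧ toR2 v ∉ convexHull ℝ (toR2 '' ((A.erase v) : Set Pt))

/-- Mixed multiplicity of a point of the first configuration. -/
def mmult (A B : Finset Pt) (v : Pt) : ℝ := mvol A B - mvol (A.erase v) B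

def dotZ (w p : Pt) : ℤ := w.1 * p.1 + w.2 * p.2

/-- `e` is the edge of `A` with primitive inner normal `w`, supported at level `c`. -/
def IsEdgeWith (A : Finset Pt) (w : Pt) (c : ℤ) (e : Finset Pt) : Prop :=
  Int.gcd w.1 w.2 = 1 ∧ (∀ a ∈ A, c ≤ dotZ w a) ∧
    e = A.filter (fun a => dotZ w a = c) ∧ 2 ≤ e.card

def IsEdge (A e : Finset Pt) : Prop := ∃ w c, IsEdgeWith A w c e

def MinOnIs (s : Finset Pt) (g : Pt → ℤ) (m : ℤ) : Prop :=
  (∃ a ∈ s, g a = m) ∧ ∀ a ∈ s, m ≤ g a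

/-- Subdiagram volume `u(e,A)` of an edge `e` of a planar configuration `A`. -/
def uEdge (A e : Finset Pt) : ℕ :=
  sSup {u : ℕ | ∃ w c, IsEdgeWith A w c e ∧ MinOnIs (A \ e) (dotZ w) (c + u)}

/-- Normalized lattice length of a segment: number of lattice points minus one. -/
def llen (e : Finset Pt) : ℕ :=
  {z : Pt | toR2 z ∈ convexHull ℝ (toR2 '' (e : Set Pt))}.ncard - 1

/-- Edges `e` of `A` and `f` of `B` are strongly parallel: parallel with the same
inner normal direction. -/
def StronglyParallel (A B e f : Finset Pt) : Prop :=
  ∃ w c c', IsEdgeWith A w c e ∧ IsEdgeWith B w c' f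

section Disc

variable (K : Type) [Field K]

/-- value of the Laurent monomial `x^a` at a point of the torus. -/
def mon2 (u : Kˣ × Kˣ) (a : Pt) : K := ((u.1 ^ a.1 * u.2 ^ a.2 : Kˣ) : K)

/-- value of a Laurent polynomial with support `B` and coefficients `h`. -/
def lval (B : Finset Pt) (h : Pt → K) (u : Kˣ × Kˣ) : K :=
  ∑ a ∈ B, h a * mon2 K u a

/-- `u` is an isolated point of `S` in the Zariski topology of the torus. -/
def IsolatedIn (S : Set (Kˣ × Kˣ)) (u : Kˣ × Kˣ) : Prop :=
  ∃ (B : Finset Pt) (h : Pt → K), lval K B h u ≠ 0 ∧ ∀ v ∈ S, lval K B h v ≠ 0 → v = u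

/-- value of the Laurent polynomial with support `A` and coefficient vector `c`. -/
def feval (A : Finset Pt) (c : {a // a ∈ A} → K) (u : Kˣ × Kˣ) : K :=
  ∑ a ∈ A.attach, c a * mon2 K u a.1

/-- the gradient `(∂f/∂x₁, ∂f/∂x₂)` at a point of the torus. -/
def fgrad (A : Finset Pt) (c : {a // a ∈ A} → K) (u : Kˣ × Kˣ) : K × K :=
  (∑ a ∈ A.attach, c a * (a.1.1 : K) * mon2 K u (a.1.1 - 1, a.1.2),
   ∑ a ∈ A.attach, c a * (a.1.2 : K) * mon2 K u (a.1.1, a.1.2 - 1))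

/-- the space of coefficient vectors of a pair of configurations. -/
abbrev Coef (A₁ A₂ : Finset Pt) : Type := ({a // a ∈ A₁} → K) × ({a // a ∈ A₂} → K)

/-- common solutions in the torus of the system `f₁ = f₂ = 0`. -/
def sols (A₁ A₂ : Finset Pt) (c : Coef K A₁ A₂) : Set (Kˣ × Kˣ) :=
  {u | feval K A₁ c.1 u = 0 ∧ feval K A₂ c.2 u = 0}

/-- the system given by `c` has a non-degenerate multiple root: an isolated common
solution in the torus at which the two gradients are linearly dependent but
each of them is nonzero. -/
def HasNDMR (A₁ A₂ : Finset Pt) (c : Coef K A₁ A₂) : Prop :=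
  ∃ u ∈ sols K A₁ A₂ c, IsolatedIn K (sols K A₁ A₂ c) u ∧
    fgrad K A₁ c.1 u ≠ 0 ∧ fgrad K A₂ c.2 u ≠ 0 ∧
    (fgrad K A₁ c.1 u).1 * (fgrad K A₂ c.2 u).2
      = (fgrad K A₁ c.1 u).2 * (fgrad K A₂ c.2 u).1

/-- the mixed discriminantal locus. -/
def discLocus (A₁ A₂ : Finset Pt) : Set (Coef K A₁ A₂) := {c | HasNDMR K A₁ A₂ c}

def pevalC {A₁ A₂ : Finset Pt} (c : Coef K A₁ A₂)
    (p : MvPolynomial ({a // a ∈ A₁} ⊕ {a // a ∈ A₂}) K) : K :=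
  MvPolynomial.eval (Sum.elim c.1 c.2) p

/-- Zariski closure in the space of coefficients. -/
def zclC {A₁ A₂ : Finset Pt} (S : Set (Coef K A₁ A₂)) : Set (Coef K A₁ A₂) :=
  {c | ∀ p : MvPolynomial ({a // a ∈ A₁} ⊕ {a // a ∈ A₂}) K,
        (∀ s ∈ S, pevalC K s p = 0) → pevalC K c p = 0}

/-- zero set over `K` of an integer polynomial in the coefficients. -/
def zeroSetC {A₁ A₂ : Finset Pt} (Δ : MvPolynomial ({a // a ∈ A₁} ⊕ {a // a ∈ A₂}) ℤ) :
    Set (Coef K A₁ A₂) :=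
  {c | pevalC K c (Δ.map (Int.castRingHom K)) = 0}

/-- `Δ` is the mixed discriminant of the pair `(A₁, A₂)`: an irreducible nonconstant
integer polynomial whose zero set is the Zariski closure of the mixed discriminantal
locus (so this closure is a hypersurface). -/
def IsMixedDisc (A₁ A₂ : Finset Pt)
    (Δ : MvPolynomial ({a // a ∈ A₁} ⊕ {a // a ∈ A₂}) ℤ) : Prop :=
  Irreducible Δ ∧ 0 < Δ.totalDegree ∧
    zeroSetC K Δ = zclC K (discLocus K A₁ A₂)

/-- the pair `(A₁,A₂)` is defective: the discriminantal variety is not a hypersurface. -/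
def DefectivePair (A₁ A₂ : Finset Pt) : Prop := ¬ ∃ Δ, IsMixedDisc K A₁ A₂ Δ

end Disc

/-- index in `ℤ⁴` of the span of the columns of the Cayley matrix of `(A₁, A₂)`. -/
def cayIdx (A₁ A₂ : Finset Pt) : ℕ :=
  (AddSubgroup.closure
    ((fun a => ((((1:ℤ),(0:ℤ)) : Pt), a)) '' (A₁ : Set Pt) ∪
     (fun b => ((((0:ℤ),(1:ℤ)) : Pt), b)) '' (A₂ : Set Pt))).index

/-- `Δt` is the mixed discriminant cycle: the mixed discriminant raised to the power
`i(A)`, or `1` in the defective case. -/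
def IsMixedDiscCycle (K : Type) [Field K] (A₁ A₂ : Finset Pt)
    (Δt : MvPolynomial ({a // a ∈ A₁} ⊕ {a // a ∈ A₂}) ℤ) : Prop :=
  (∃ Δ, IsMixedDisc K A₁ A₂ Δ ∧ Δt = Δ ^ cayIdx A₁ A₂) ∨
    (DefectivePair K A₁ A₂ ∧ Δt = 1)

/-- degree in the block of variables indexed by the first configuration. -/
def blockDegL {A₁ A₂ : Finset Pt}
    (p : MvPolynomial ({a // a ∈ A₁} ⊕ {a // a ∈ A₂}) ℤ) : ℕ :=
  p.support.sup fun m => m.sum fun x k => if x.isLeft then k else 0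

/-- degree in the block of variables indexed by the second configuration. -/
def blockDegR {A₁ A₂ : Finset Pt}
    (p : MvPolynomial ({a // a ∈ A₁} ⊕ {a // a ∈ A₂}) ℤ) : ℕ :=
  p.support.sup fun m => m.sum fun x k => if x.isRight then k else 0

end

section MinkowskiRemoval

variable {E : Type*} [AddCommGroup E] [Module ℝ E] {K K' P : Set E} {v p : E}

/-- If `K` lies in the hull of `K'` and `v`, and `P` in the translate to `p` of the cone of `K'` at
`v`, then the sums `K' + P` and `p + K` meet inside `p + K'`. -/
theorem add_inter_vadd_subset_of_cone (hK' : Convex ℝ K')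
    (hK : ∀ k ∈ K, ∃ t : ℝ, 0 ≤ t ∧ t ≤ 1 ∧ ∃ y ∈ K', k = (1 - t) • v + t • y)
    (hP : ∀ q ∈ P, ∃ s : ℝ, 0 ≤ s ∧ ∃ y ∈ K', q = p + s • (y - v)) :
    (K' + P) ∩ (p +ᵥ K) ⊆ p +ᵥ K' := by
  rintro _ ⟨⟨k', hk', q, hq, rfl⟩, ⟨k, hk, hkq⟩⟩
  obtain ⟨t, ht0, ht1, y, hy, rfl⟩ := hK k hk
  obtain ⟨s, hs, z, hz, rfl⟩ := hP q hq
  rcases eq_or_lt_of_le ht1 with rfl | ht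
  · refine ⟨y, hy, ?_⟩
    simpa using hkq
  refine ⟨(1 - t) • v + t • y, ?_, hkq⟩
  have hpos : 0 < 1 - t + s := by linarith
  have hne : 1 - t + s ≠ 0 := hpos.ne'
  have hx : (1 - t) • v + t • y = k' + s • (z - v) := by
    have : p + ((1 - t) • v + t • y) = p + (k' + s • (z - v)) := by
      simp only [vadd_eq_add] at hkq
      rw [hkq]; abel
    exact add_left_cancel this
  have hmix : (1 - t) • v + t • y =
      ((1 - t) / (1 - t + s)) • k' + (s / (1 - t + s)) • ((1 - t) • z + t • y) := by
    have hk'' : k' = (1 - t) • v + t • y - s • (z - v) := by rw [hx]; abel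
    rw [hk'']
    match_scalars <;> field_simp <;> ring
  rw [hmix]
  refine hK' hk' (hK' hz hy (by linarith) ht0 (by ring)) (by positivity) (by positivity) ?_
  field_simp

theorem add_subset_union_vadd_of_cone (hK' : Convex ℝ K')
    (hK : ∀ k, k ∈ K ↔ ∃ t : ℝ, 0 ≤ t ∧ t ≤ 1 ∧ ∃ y ∈ K', k = (1 - t) • v + t • y)
    (hPc : Convex ℝ P) (hp : p ∈ P)
    (hP : ∀ q ∈ P, ∃ s : ℝ, 0 ≤ s ∧ ∃ y ∈ K', q = p + s • (y - v)) :
    K + P ⊆ (K' + P) ∪ (p +ᵥ K) := by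
  rintro _ ⟨k, hk, q, hq, rfl⟩
  obtain ⟨t, ht0, ht1, y, hy, rfl⟩ := (hK k).1 hk
  obtain ⟨s, hs, z, hz, hqz⟩ := hP q hq
  rcases le_or_gt s (1 - t) with hst | hst
  · right
    rcases eq_or_lt_of_le (add_nonneg ht0 hs) with h0 | h0
    · have ht : t = 0 := by linarith
      have hs' : s = 0 := by linarith
      refine ⟨_, hk, ?_⟩
      simp [hqz, ht, hs', add_comm]
    · refine ⟨(1 - (t + s)) • v + (t + s) • ((t / (t + s)) • y + (s / (t + s)) • z),
        (hK _).2 ⟨t + s, h0.le, by linarith, _,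
          hK' hy hz (by positivity) (by positivity) (by field_simp), rfl⟩, ?_⟩
      have hne : t + s ≠ 0 := h0.ne'
      simp only [hqz, vadd_eq_add]
      match_scalars <;> (field_simp; try ring)
  · left
    have hs0 : 0 < s := by linarith
    refine ⟨t • y + (1 - t) • z, hK' hy hz ht0 (by linarith) (by ring),
      ((1 - t) / s) • p + (1 - (1 - t) / s) • q,
      hPc hp hq (div_nonneg (by linarith) hs) ?_ (by ring), ?_⟩
    · rw [sub_nonneg, div_le_one hs0]; exact hst.le
    · simp only [hqz]
      match_scalars <;> field_simp <;> ring

/-- Adding `P` to the hull `K` of `K'` and a point `v` changes the Minkowski sum exactly by a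
translate of `K \ K'`, provided `P` lies in the translate to `p ∈ P` of the cone of `K'` at `v`. -/
theorem add_eq_union_vadd_of_cone
    (hK' : Convex ℝ K')
    (hK : ∀ k, k ∈ K ↔ ∃ t : ℝ, 0 ≤ t ∧ t ≤ 1 ∧ ∃ y ∈ K', k = (1 - t) • v + t • y)
    (hPc : Convex ℝ P) (hp : p ∈ P)
    (hP : ∀ q ∈ P, ∃ s : ℝ, 0 ≤ s ∧ ∃ y ∈ K', q = p + s • (y - v)) :
    K + P = (K' + P) ∪ (p +ᵥ K) ∧ (K' + P) ∩ (p +ᵥ K) = p +ᵥ K' := by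
  have hsub : K' ⊆ K := fun y hy => (hK y).2 ⟨1, zero_le_one, le_rfl, y, hy, by simp⟩
  refine ⟨(add_subset_union_vadd_of_cone hK' hK hPc hp hP).antisymm ?_,
    (add_inter_vadd_subset_of_cone hK' (fun k => (hK k).1) hP).antisymm ?_⟩
  · rintro _ (h | ⟨k, hk, rfl⟩)
    · exact Set.add_subset_add_right hsub h
    · exact ⟨k, hk, p, hp, by simp [add_comm]⟩
  · rintro _ ⟨k, hk, rfl⟩
    exact ⟨⟨k, hk, p, hp, by simp [add_comm]⟩, ⟨k, hsub hk, rfl⟩⟩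

end MinkowskiRemoval

theorem toR2_add (a b : Pt) : toR2 (a + b) = toR2 a + toR2 b := by
  simp [toR2]

theorem convexHull_toR2_add (A B : Finset Pt) :
    convexHull ℝ (toR2 '' ((A + B : Finset Pt) : Set Pt)) =
      convexHull ℝ (toR2 '' (A : Set Pt)) + convexHull ℝ (toR2 '' (B : Set Pt)) := by
  rw [← convexHull_add, Finset.coe_add]
  congr 1
  exact Set.image_image2_distrib (fun a b => toR2_add a b)

theorem isCompact_convexHull_toR2 (A : Finset Pt) :
    IsCompact (convexHull ℝ (toR2 '' (A : Set Pt))) :=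
  Set.Finite.isCompact_convexHull ℝ (A.finite_toSet.image toR2)

theorem collinear_of_dotZ_eq {A : Finset Pt} {w p : Pt} (hw : w ≠ 0)
    (h : ∀ a ∈ A, dotZ w a = dotZ w p) : Collinear ℝ (toR2 '' (A : Set Pt)) := by
  rw [collinear_iff_exists_forall_eq_smul_vadd]
  have hpos : (0 : ℝ) < (w.1 : ℝ) ^ 2 + (w.2 : ℝ) ^ 2 := by
    rcases eq_or_ne w.1 0 with h1 | h1
    · have h2 : w.2 ≠ 0 := fun h2 => hw (Prod.ext h1 h2)
      positivity
    · positivity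
  refine ⟨toR2 p, (-(w.2 : ℝ), (w.1 : ℝ)), ?_⟩
  rintro _ ⟨a, ha, rfl⟩
  have hd : (w.1 : ℝ) * a.1 + w.2 * a.2 = w.1 * p.1 + w.2 * p.2 := by
    exact_mod_cast h a ha
  refine ⟨(-(w.2 : ℝ) * (a.1 - p.1) + w.1 * (a.2 - p.2)) / ((w.1 : ℝ) ^ 2 + (w.2 : ℝ) ^ 2), ?_⟩
  ext
  · simp only [toR2, vadd_eq_add, Prod.fst_add, Prod.smul_fst, smul_eq_mul]
    field_simp
    linear_combination (w.1 : ℝ) * hd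
  · simp only [toR2, vadd_eq_add, Prod.snd_add, Prod.smul_snd, smul_eq_mul]
    field_simp
    linear_combination (w.2 : ℝ) * hd

/-- The oriented area `det (a - v, b - v)`. -/
def orient (v a b : Pt) : ℤ := (a.1 - v.1) * (b.2 - v.2) - (a.2 - v.2) * (b.1 - v.1)

/-- A vertex is the unique minimiser of some linear functional. -/
theorem IsVertex.exists_functional {A : Finset Pt} {v : Pt} (hv : IsVertex A v) :
    ∃ α β : ℝ, ∀ a ∈ A.erase v, 0 < α * (a.1 - v.1) + β * (a.2 - v.2) := by
  obtain ⟨f, u, hfu, hf⟩ := geometric_hahn_banach_point_closed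
    (convex_convexHull ℝ (toR2 '' (A.erase v : Set Pt)))
    (by simpa using (isCompact_convexHull_toR2 (A.erase v)).isClosed) hv.2
  have hlin : ∀ x y : ℝ, f (x, y) = f (1, 0) * x + f (0, 1) * y := by
    intro x y
    have : ((x, y) : ℝ × ℝ) = x • (1, 0) + y • (0, 1) := by simp
    rw [this, map_add, map_smul, map_smul]
    simp [mul_comm]
  refine ⟨f (1, 0), f (0, 1), fun a ha => ?_⟩
  have h := hf (toR2 a) (subset_convexHull ℝ _ ⟨a, by simpa [and_comm] using ha, rfl⟩)
  rw [toR2, hlin] at h hfu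
  linarith

/-- The two extreme rays of the tangent cone at a vertex. -/
theorem IsVertex.exists_extreme_rays {A : Finset Pt} {v : Pt} (hA : FullDim A)
    (hv : IsVertex A v) :
    ∃ a₁ ∈ A.erase v, ∃ a₂ ∈ A.erase v, 0 < orient v a₁ a₂ ∧
      ∀ a ∈ A, 0 ≤ orient v a₁ a ∧ 0 ≤ orient v a a₂ := by
  obtain ⟨α, β, hpos⟩ := hv.exists_functional
  have hne : (A.erase v).Nonempty := by
    rw [Finset.nonempty_iff_ne_empty]
    intro h
    refine hA ((collinear_singleton ℝ (toR2 v)).subset ?_)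
    rintro _ ⟨a, ha, rfl⟩
    by_contra hav
    have : a ∈ A.erase v := Finset.mem_erase.2 ⟨fun h => hav (by simp [h]), ha⟩
    simp [h] at this
  let r : Pt → ℝ := fun a =>
    (-β * (a.1 - v.1) + α * (a.2 - v.2)) / (α * (a.1 - v.1) + β * (a.2 - v.2))
  have hr : ∀ a ∈ A.erase v, ∀ b ∈ A.erase v, r a ≤ r b → 0 ≤ orient v a b := by
    intro a ha b hb hab
    have h1 := hpos a ha
    have h2 := hpos b hb
    rw [div_le_div_iff₀ h1 h2] at hab
    have hαβ : 0 < α ^ 2 + β ^ 2 := by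
      rcases eq_or_ne α 0 with h | h
      · rcases eq_or_ne β 0 with h' | h'
        · simp [h, h'] at h1
        · positivity
      · positivity
    have : 0 ≤ (α ^ 2 + β ^ 2) * (orient v a b : ℝ) := by
      simp only [orient]
      push_cast
      linarith
    exact_mod_cast nonneg_of_mul_nonneg_right this hαβ
  obtain ⟨a₁, h₁, hmin⟩ := (A.erase v).exists_min_image r hne
  obtain ⟨a₂, h₂, hmax⟩ := (A.erase v).exists_max_image r hne
  have hall : ∀ a ∈ A, 0 ≤ orient v a₁ a ∧ 0 ≤ orient v a a₂ := by
    intro a ha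
    rcases eq_or_ne a v with rfl | hav
    · simp [orient]
    · have ha' := Finset.mem_erase.2 ⟨hav, ha⟩
      exact ⟨hr _ h₁ _ ha' (hmin a ha'), hr _ ha' _ h₂ (hmax a ha')⟩
  refine ⟨a₁, h₁, a₂, h₂, lt_of_le_of_ne (hall a₂ (Finset.mem_of_mem_erase h₂)).1 ?_, hall⟩
  intro h0
  refine hA (collinear_of_dotZ_eq (w := (-(a₁.2 - v.2), a₁.1 - v.1)) (p := v) ?_ ?_)
  · intro h
    have e1 : -(a₁.2 - v.2) = 0 := congrArg Prod.fst h
    have e2 : a₁.1 - v.1 = 0 := congrArg Prod.snd h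
    exact Finset.ne_of_mem_erase h₁ (Prod.ext (by omega) (by omega))
  · intro a ha
    suffices h : orient v a₁ a = 0 by
      simp only [orient, dotZ] at h ⊢
      linarith
    have p1 := hpos a₁ h₁
    have p2 := hpos a₂ h₂
    obtain ⟨q1, q2⟩ := hall a ha
    have hid : (α * (a₁.1 - v.1) + β * (a₁.2 - v.2)) * (orient v a a₂ : ℝ)
        + (α * (a₂.1 - v.1) + β * (a₂.2 - v.2)) * (orient v a₁ a : ℝ)
        = (α * (a.1 - v.1) + β * (a.2 - v.2)) * (orient v a₁ a₂ : ℝ) := by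
      simp only [orient]
      push_cast
      ring
    rw [← h0] at hid
    have q1' : (0 : ℝ) ≤ orient v a₁ a := by exact_mod_cast q1
    have q2' : (0 : ℝ) ≤ orient v a a₂ := by exact_mod_cast q2
    have : (orient v a₁ a : ℝ) = 0 := by
      have := mul_nonneg p1.le q2'
      have := mul_nonneg p2.le q1'
      have h3 : (α * (a₂.1 - v.1) + β * (a₂.2 - v.2)) * (orient v a₁ a : ℝ) = 0 := by
        push_cast at hid
        linarith
      exact (mul_eq_zero.1 h3).resolve_left p2.ne'
    exact_mod_cast this

/-- If the line through two points of `B` with normal `w` supports `B`, and each edge of `B` is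
strongly parallel to an edge of `A`, then `w` has no unique minimiser on `A`. -/
theorem not_unique_min_of_supporting_line {A B : Finset Pt} (hB : FullDim B)
    (hpar : ∀ e, IsEdge B e → ∃ f, StronglyParallel B A e f)
    {w p b v : Pt} (hv : v ∈ A) (hw : w ≠ 0) (hp : p ∈ B) (hb : b ∈ B) (hpb : p ≠ b)
    (hwb : dotZ w b = dotZ w p) (hmin : ∀ c ∈ B, dotZ w p ≤ dotZ w c) :
    ¬ ∀ a ∈ A.erase v, dotZ w v < dotZ w a := by
  intro huniq
  obtain ⟨c, hc, hpc⟩ : ∃ c ∈ B, dotZ w p < dotZ w c := by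
    by_contra! hcon
    exact hB (collinear_of_dotZ_eq hw fun c hc => le_antisymm (hcon c hc) (hmin c hc))
  have hg : 0 < Int.gcd w.1 w.2 := by
    rw [Int.gcd_pos_iff]
    by_contra! h
    exact hw (Prod.ext h.1 h.2)
  obtain ⟨w', hgw, hw1, hw2⟩ : ∃ w' : Pt, Int.gcd w'.1 w'.2 = 1 ∧
      w.1 = Int.gcd w.1 w.2 * w'.1 ∧ w.2 = Int.gcd w.1 w.2 * w'.2 :=
    ⟨(w.1 / Int.gcd w.1 w.2, w.2 / Int.gcd w.1 w.2), Int.gcd_div_gcd_div_gcd hg,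
      (Int.mul_ediv_cancel' (Int.gcd_dvd_left ..)).symm,
      (Int.mul_ediv_cancel' (Int.gcd_dvd_right ..)).symm⟩
  have hg' : (0 : ℤ) < Int.gcd w.1 w.2 := by exact_mod_cast hg
  have hdot : ∀ x, dotZ w x = Int.gcd w.1 w.2 * dotZ w' x := by
    intro x
    calc dotZ w x = w.1 * x.1 + w.2 * x.2 := rfl
      _ = (Int.gcd w.1 w.2 * w'.1) * x.1 + (Int.gcd w.1 w.2 * w'.2) * x.2 := by rw [← hw1, ← hw2]
      _ = _ := by simp only [dotZ]; ring
  have hedge : IsEdgeWith B w' (dotZ w' p) (B.filter fun a => dotZ w' a = dotZ w' p) := by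
    refine ⟨hgw, fun a ha => ?_, rfl, ?_⟩
    · have := hmin a ha
      rw [hdot, hdot] at this
      exact le_of_mul_le_mul_left this hg'
    · refine Finset.one_lt_card.2 ⟨p, by simp [hp], b, ?_, hpb⟩
      rw [hdot, hdot] at hwb
      simp [hb, mul_left_cancel₀ hg'.ne' hwb]
  obtain ⟨f, n, d, d', ⟨hn, hnB, he, -⟩, -, hnA, hf, hf2⟩ := hpar _ ⟨_, _, hedge⟩
  have hnp : dotZ n p = d := by
    have : p ∈ B.filter fun a => dotZ n a = d := by rw [← he]; simp [hp]
    simpa [hp] using this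
  have hnb : dotZ n b = d := by
    have : b ∈ B.filter fun a => dotZ n a = d := by
      rw [← he]
      rw [hdot, hdot] at hwb
      simp [hb, mul_left_cancel₀ hg'.ne' hwb]
    simpa [hb] using this
  have hne : b.1 - p.1 ≠ 0 ∨ b.2 - p.2 ≠ 0 := by
    by_contra! h
    exact hpb (Prod.ext (by omega) (by omega))
  have hpara : w.1 * n.2 = w.2 * n.1 := by
    have e1 : w.1 * (b.1 - p.1) + w.2 * (b.2 - p.2) = 0 := by
      simp only [dotZ] at hwb; linarith
    have e2 : n.1 * (b.1 - p.1) + n.2 * (b.2 - p.2) = 0 := by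
      simp only [dotZ] at hnb hnp; linarith
    rcases hne with h | h
    · refine mul_right_cancel₀ h ?_
      linear_combination n.2 * e1 - w.2 * e2
    · refine mul_right_cancel₀ h ?_
      linear_combination w.1 * e2 - n.1 * e1
  have hswap : ∀ a, (dotZ n c - dotZ n p) * (dotZ w a - dotZ w v) =
      (dotZ w c - dotZ w p) * (dotZ n a - dotZ n v) := by
    intro a
    simp only [dotZ]
    linear_combination ((c.2 - p.2) * (a.1 - v.1) - (c.1 - p.1) * (a.2 - v.2)) * hpara
  have hnc : dotZ n p < dotZ n c := by
    refine lt_of_le_of_ne (hnp ▸ hnB c hc) fun h => ?_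
    have hz : ∀ x : Pt, dotZ n x = 0 := by
      intro x
      have : (dotZ w c - dotZ w p) * dotZ n x = (dotZ n c - dotZ n p) * dotZ w x := by
        simp only [dotZ]
        linear_combination ((c.1 - p.1) * x.2 - (c.2 - p.2) * x.1) * hpara
      rw [h, sub_self, zero_mul] at this
      exact (mul_eq_zero.1 this).resolve_left (by omega)
    have z1 := hz (1, 0)
    have z2 := hz (0, 1)
    simp only [dotZ] at z1 z2
    have z1' : n.1 = 0 := by simpa using z1
    have z2' : n.2 = 0 := by simpa using z2
    simp [z1', z2'] at hn
  have hnuniq : ∀ a ∈ A.erase v, dotZ n v < dotZ n a := by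
    intro a ha
    have h1 : 0 < (dotZ n c - dotZ n p) * (dotZ w a - dotZ w v) :=
      mul_pos (by linarith) (by linarith [huniq a ha])
    rw [hswap a] at h1
    linarith [pos_of_mul_pos_right h1 (by linarith)]
  obtain ⟨x, hx, y, hy, hxy⟩ := Finset.one_lt_card.1 hf2
  rw [hf, Finset.mem_filter] at hx hy
  have heq : ∀ z ∈ A, dotZ n z = d' → z = v := by
    intro z hz hzd
    by_contra hzv
    have := hnuniq z (Finset.mem_erase.2 ⟨hzv, hz⟩)
    have := hnA v hv
    omega
  exact hxy ((heq x hx.1 hx.2).trans (heq y hy.1 hy.2).symm)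

/-- If each edge of `B` is strongly parallel to an edge of `A`, then `B` lies in a translate, with
apex in `B`, of the tangent cone of `A` at a vertex. -/
theorem exists_apex_of_parallel_edges {A B : Finset Pt} (hB : FullDim B)
    (hpar : ∀ e, IsEdge B e → ∃ f, StronglyParallel B A e f) {v a₁ a₂ : Pt}
    (hv : v ∈ A) (hD : 0 < orient v a₁ a₂)
    (hall : ∀ a ∈ A, 0 ≤ orient v a₁ a ∧ 0 ≤ orient v a a₂) :
    ∃ p ∈ B, ∀ b ∈ B, 0 ≤ orient 0 (a₁ - v) (b - p) ∧ 0 ≤ orient 0 (b - p) (a₂ - v) := by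
  have hBne : B.Nonempty := by
    rw [Finset.nonempty_iff_ne_empty]
    rintro rfl
    exact hB (by simp [collinear_empty])
  let n₁ : Pt → ℤ := fun x => orient 0 (a₁ - v) x
  let n₂ : Pt → ℤ := fun x => orient 0 x (a₂ - v)
  obtain ⟨p₀, hp₀, hp₀min⟩ := B.exists_min_image n₁ hBne
  obtain ⟨p, hp, hpmin⟩ := (B.filter fun b => n₁ b = n₁ p₀).exists_min_image n₂
    ⟨p₀, by simp [hp₀]⟩
  rw [Finset.mem_filter] at hp
  have hmin₁ : ∀ b ∈ B, n₁ p ≤ n₁ b := fun b hb => hp.2 ▸ hp₀min b hb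
  have hmin₂ : ∀ b ∈ B, n₂ p ≤ n₂ b := by
    by_contra! hcon
    obtain ⟨b₀, hb₀, hlt₀⟩ := hcon
    have hstrict : ∀ b ∈ B, n₂ b < n₂ p → n₁ p < n₁ b := by
      intro b hb hlt
      refine lt_of_le_of_ne (hmin₁ b hb) fun h => ?_
      exact absurd (hpmin b (Finset.mem_filter.2 ⟨hb, by rw [← h, hp.2]⟩)) (not_le.2 hlt)
    obtain ⟨b, hb, hbmax⟩ := (B.filter fun b => n₂ b < n₂ p).exists_max_image
      (fun b => ((n₂ p - n₂ b : ℤ) : ℚ) / ((n₁ b - n₁ p : ℤ) : ℚ)) ⟨b₀, by simp [hb₀, hlt₀]⟩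
    rw [Finset.mem_filter] at hb
    have hβ := hstrict b hb.1 hb.2
    let w : Pt := (-(n₂ p - n₂ b) * (a₁.2 - v.2) + (n₁ b - n₁ p) * (a₂.2 - v.2),
      (n₂ p - n₂ b) * (a₁.1 - v.1) - (n₁ b - n₁ p) * (a₂.1 - v.1))
    have hw : ∀ x y, dotZ w x - dotZ w y =
        (n₂ p - n₂ b) * (n₁ x - n₁ y) + (n₁ b - n₁ p) * (n₂ x - n₂ y) := by
      intro x y
      simp only [dotZ, w, n₁, n₂, orient, Prod.fst_sub, Prod.snd_sub, Prod.fst_zero, Prod.snd_zero]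
      ring
    have hv₁ : ∀ a, n₁ a - n₁ v = orient v a₁ a := by
      intro a
      simp only [n₁, orient, Prod.fst_sub, Prod.snd_sub, Prod.fst_zero, Prod.snd_zero]
      ring
    have hv₂ : ∀ a, n₂ a - n₂ v = orient v a a₂ := by
      intro a
      simp only [n₂, orient, Prod.fst_sub, Prod.snd_sub, Prod.fst_zero, Prod.snd_zero]
      ring
    refine not_unique_min_of_supporting_line (w := w) (p := p) (b := b) (v := v) hB hpar hv ?_ hp.1
      hb.1 ?_ ?_ ?_ ?_
    · intro h0
      have := hw a₂ v
      rw [hv₁, hv₂, h0] at this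
      have h2 : orient v a₂ a₂ = 0 := by simp only [orient]; ring
      have h3 : 0 < (n₂ p - n₂ b) * orient v a₁ a₂ := mul_pos (by linarith) hD
      simp only [dotZ, Prod.fst_zero, Prod.snd_zero, h2] at this
      linarith
    · rintro rfl
      exact lt_irrefl _ hβ
    · have := hw b p
      linarith
    · intro c hc
      have hwc := hw c p
      have hc₁ := hmin₁ c hc
      suffices h : 0 ≤ (n₂ p - n₂ b) * (n₁ c - n₁ p) + (n₁ b - n₁ p) * (n₂ c - n₂ p) by linarith
      rcases lt_or_ge (n₂ c) (n₂ p) with hlt | hge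
      · have hmax := hbmax c (Finset.mem_filter.2 ⟨hc, hlt⟩)
        have hγ := hstrict c hc hlt
        rw [div_le_div_iff₀ (by exact_mod_cast sub_pos.2 hγ) (by exact_mod_cast sub_pos.2 hβ)]
          at hmax
        have hmax' : (n₂ p - n₂ c) * (n₁ b - n₁ p) ≤ (n₂ p - n₂ b) * (n₁ c - n₁ p) := by
          exact_mod_cast hmax
        linarith
      · exact add_nonneg (mul_nonneg (by linarith) (by linarith))
          (mul_nonneg (by linarith) (by linarith))
    · intro a ha
      have hwa := hw a v
      rw [hv₁, hv₂] at hwa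
      obtain ⟨q₁, q₂⟩ := hall a (Finset.mem_of_mem_erase ha)
      have hα : 0 < n₂ p - n₂ b := by linarith
      have hβ' : 0 < n₁ b - n₁ p := by linarith
      have m₁ := mul_nonneg hα.le q₁
      have m₂ := mul_nonneg hβ'.le q₂
      by_contra! hle
      have z₁ : orient v a₁ a = 0 :=
        (mul_eq_zero.1 (by linarith : (n₂ p - n₂ b) * orient v a₁ a = 0)).resolve_left hα.ne'
      have z₂ : orient v a a₂ = 0 :=
        (mul_eq_zero.1 (by linarith : (n₁ b - n₁ p) * orient v a a₂ = 0)).resolve_left hβ'.ne'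
      refine Finset.ne_of_mem_erase ha (Prod.ext ?_ ?_)
      · have : orient v a₁ a₂ * (a.1 - v.1) = 0 := by
          have : orient v a₁ a₂ * (a.1 - v.1) =
              orient v a a₂ * (a₁.1 - v.1) + orient v a₁ a * (a₂.1 - v.1) := by
            simp only [orient]; ring
          rw [this, z₁, z₂]; ring
        have := (mul_eq_zero.1 this).resolve_left hD.ne'
        linarith
      · have : orient v a₁ a₂ * (a.2 - v.2) = 0 := by
          have : orient v a₁ a₂ * (a.2 - v.2) =
              orient v a a₂ * (a₁.2 - v.2) + orient v a₁ a * (a₂.2 - v.2) := by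
            simp only [orient]; ring
          rw [this, z₁, z₂]; ring
        have := (mul_eq_zero.1 this).resolve_left hD.ne'
        linarith
  refine ⟨p, hp.1, fun b hb => ⟨?_, ?_⟩⟩
  · have := hmin₁ b hb
    simp only [n₁, orient, Prod.fst_sub, Prod.snd_sub, Prod.fst_zero, Prod.snd_zero] at this ⊢
    linarith
  · have := hmin₂ b hb
    simp only [n₂, orient, Prod.fst_sub, Prod.snd_sub, Prod.fst_zero, Prod.snd_zero] at this ⊢
    linarith

/-- The convex hull of a set lies in a cone spanned by two vectors `a₁ - v`, `a₂ - v` as soon as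
the set does, the cone being given by determinantal inequalities. -/
theorem exists_smul_of_mem_convexHull {B : Finset Pt} {v a₁ a₂ p : Pt}
    (hD : 0 < orient v a₁ a₂)
    (hB : ∀ b ∈ B, 0 ≤ orient 0 (a₁ - v) (b - p) ∧ 0 ≤ orient 0 (b - p) (a₂ - v))
    {K' : Set (ℝ × ℝ)} (hK' : Convex ℝ K') (h₁ : toR2 a₁ ∈ K') (h₂ : toR2 a₂ ∈ K') :
    ∀ q ∈ convexHull ℝ (toR2 '' (B : Set Pt)),
      ∃ s : ℝ, 0 ≤ s ∧ ∃ y ∈ K', q = toR2 p + s • (y - toR2 v) := by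
  have hD' : (0 : ℝ) < (a₁.1 - v.1) * (a₂.2 - v.2) - (a₁.2 - v.2) * (a₂.1 - v.1) := by
    simp only [orient] at hD
    exact_mod_cast hD
  have hcone : ∀ q ∈ convexHull ℝ (toR2 '' (B : Set Pt)),
      0 ≤ ((a₁.1 : ℝ) - v.1) * (q.2 - p.2) - (a₁.2 - v.2) * (q.1 - p.1) ∧
      0 ≤ (q.1 - p.1) * ((a₂.2 : ℝ) - v.2) - (q.2 - p.2) * (a₂.1 - v.1) := by
    refine convexHull_min (t := {q | _}) ?_ ?_
    · rintro _ ⟨b, hb, rfl⟩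
      have := hB b hb
      simp only [orient, Prod.fst_sub, Prod.snd_sub, Prod.fst_zero, Prod.snd_zero, sub_zero]
        at this
      simp only [Set.mem_ofPred_eq, toR2]
      exact_mod_cast this
    · rintro x ⟨hx₁, hx₂⟩ y ⟨hy₁, hy₂⟩ s t hs ht hst
      obtain rfl : s = 1 - t := by linarith
      simp only [Set.mem_ofPred_eq, Prod.fst_add, Prod.snd_add, Prod.smul_fst, Prod.smul_snd,
        smul_eq_mul]
      constructor
      · linarith [mul_nonneg hs hx₁, mul_nonneg ht hy₁]
      · linarith [mul_nonneg hs hx₂, mul_nonneg ht hy₂]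
  intro q hq
  obtain ⟨q₁, q₂⟩ := hcone q hq
  set D := ((a₁.1 : ℝ) - v.1) * (a₂.2 - v.2) - (a₁.2 - v.2) * (a₂.1 - v.1) with hDdef
  set c₂ := ((a₁.1 : ℝ) - v.1) * (q.2 - p.2) - (a₁.2 - v.2) * (q.1 - p.1) with hc₂
  set c₁ := (q.1 - p.1) * ((a₂.2 : ℝ) - v.2) - (q.2 - p.2) * (a₂.1 - v.1) with hc₁
  have hq₁ : D * (q.1 - p.1) = c₁ * (a₁.1 - v.1) + c₂ * (a₂.1 - v.1) := by
    rw [hDdef, hc₁, hc₂]; ring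
  have hq₂ : D * (q.2 - p.2) = c₁ * (a₁.2 - v.2) + c₂ * (a₂.2 - v.2) := by
    rw [hDdef, hc₁, hc₂]; ring
  clear_value D c₁ c₂
  rcases eq_or_lt_of_le (add_nonneg q₂ q₁) with h0 | h0
  · have z₁ : c₁ = 0 := by linarith
    have z₂ : c₂ = 0 := by linarith
    refine ⟨0, le_rfl, toR2 a₁, h₁, ?_⟩
    simp only [z₁, z₂, zero_mul, add_zero, mul_eq_zero, hD'.ne', false_or] at hq₁ hq₂
    ext <;> simp [toR2] <;> linarith
  · refine ⟨(c₁ + c₂) / D, by positivity,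
      (c₁ / (c₁ + c₂)) • toR2 a₁ + (c₂ / (c₁ + c₂)) • toR2 a₂,
      hK' h₁ h₂ (by positivity) (by positivity) (by field_simp), ?_⟩
    have hs := h0.ne'
    have hDne := hD'.ne'
    ext
    · simp only [toR2, Prod.fst_add, Prod.smul_fst, Prod.fst_sub, smul_eq_mul]
      field_simp
      linarith
    · simp only [toR2, Prod.snd_add, Prod.smul_snd, Prod.snd_sub, smul_eq_mul]
      field_simp
      linarith

/-- If each edge of `B` is strongly parallel to an edge of `A`, then every vertex of `A` has mixed
multiplicity zero. -/
theorem mmult_eq_zero_of_parallel_edges {A B : Finset Pt} (hA : FullDim A) (hB : FullDim B)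
    (hpar : ∀ e, IsEdge B e → ∃ f, StronglyParallel B A e f) {v : Pt} (hv : IsVertex A v) :
    mmult A B v = 0 := by
  obtain ⟨a₁, h₁, a₂, h₂, hD, hall⟩ := hv.exists_extreme_rays hA
  obtain ⟨p, hp, hcone⟩ := exists_apex_of_parallel_edges hB hpar hv.1 hD hall
  set K := convexHull ℝ (toR2 '' (A : Set Pt)) with hK
  set K' := convexHull ℝ (toR2 '' (A.erase v : Finset Pt)) with hK'
  set P := convexHull ℝ (toR2 '' (B : Set Pt)) with hP
  have hKmem : ∀ k, k ∈ K ↔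
      ∃ t : ℝ, 0 ≤ t ∧ t ≤ 1 ∧ ∃ y ∈ K', k = (1 - t) • toR2 v + t • y := by
    have hins : toR2 '' (A : Set Pt) = insert (toR2 v) (toR2 '' (A.erase v : Finset Pt)) := by
      rw [← Set.image_insert_eq, ← Finset.coe_insert, Finset.insert_erase hv.1]
    intro k
    rw [hK, hins, convexHull_insert (Set.Nonempty.image _ ⟨a₁, h₁⟩), mem_convexJoin]
    simp only [Set.mem_singleton_iff, exists_eq_left, segment_eq_image, Set.mem_image, Set.mem_Icc]
    constructor
    · rintro ⟨y, hy, t, ⟨ht0, ht1⟩, rfl⟩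
      exact ⟨t, ht0, ht1, y, hy, rfl⟩
    · rintro ⟨t, ht0, ht1, y, hy, rfl⟩
      exact ⟨y, hy, t, ⟨ht0, ht1⟩, rfl⟩
  have hmem : ∀ a ∈ A.erase v, toR2 a ∈ K' := fun a ha => subset_convexHull ℝ _ ⟨a, ha, rfl⟩
  obtain ⟨hunion, hinter⟩ := add_eq_union_vadd_of_cone (convex_convexHull ℝ _) hKmem
    (convex_convexHull ℝ _) (subset_convexHull ℝ _ ⟨p, hp, rfl⟩ : toR2 p ∈ P)
    (exists_smul_of_mem_convexHull hD hcone (convex_convexHull ℝ _) (hmem _ h₁) (hmem _ h₂))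
  have hKc : IsCompact K := isCompact_convexHull_toR2 A
  have hKc' : IsCompact K' := isCompact_convexHull_toR2 (A.erase v)
  have hPc : IsCompact P := isCompact_convexHull_toR2 B
  have hvol := measure_union_add_inter (μ := (volume : Measure (ℝ × ℝ))) (K' + P)
    (hKc.vadd (toR2 p)).measurableSet
  rw [← hunion, hinter, measure_vadd, measure_vadd] at hvol
  have hreal := congrArg ENNReal.toReal hvol
  rw [ENNReal.toReal_add (hKc.add hPc).measure_lt_top.ne hKc'.measure_lt_top.ne,
    ENNReal.toReal_add (hKc'.add hPc).measure_lt_top.ne hKc.measure_lt_top.ne] at hreal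
  simp only [mmult, mvol, narea, convexHull_toR2_add]
  rw [← hK, ← hK', ← hP]
  linarith

/-- **Proposition 3.9 (2).**  If every edge of `A₂` is strongly parallel to some edge of
`A₁`, then every vertex of `A₁` has mixed multiplicity zero (and hence the sum of the
mixed multiplicities over the vertices of `A₁` vanishes); and symmetrically. -/
theorem sum_mixed_multiplicities_eq_zero_of_no_nonparallel_edges
    (A₁ A₂ : Finset Pt) (h₁ : FullDim A₁) (h₂ : FullDim A₂) :
    ((∀ e, IsEdge A₂ e → ∃ f, StronglyParallel A₂ A₁ e f) →
      (∑ᶠ v ∈ {v : Pt | IsVertex A₁ v}, mmult A₁ A₂ v) = 0 ∧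
        ∀ v, IsVertex A₁ v → mmult A₁ A₂ v = 0)
    ∧ ((∀ e, IsEdge A₁ e → ∃ f, StronglyParallel A₁ A₂ e f) →
      (∑ᶠ v ∈ {v : Pt | IsVertex A₂ v}, mmult A₂ A₁ v) = 0 ∧
        ∀ v, IsVertex A₂ v → mmult A₂ A₁ v = 0) := by
  have key : ∀ {A B : Finset Pt}, FullDim A → FullDim B →
      (∀ e, IsEdge B e → ∃ f, StronglyParallel B A e f) →
      (∑ᶠ v ∈ {v : Pt | IsVertex A v}, mmult A B v) = 0 ∧
        ∀ v, IsVertex A v → mmult A B v = 0 := fun hA hB hpar =>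
    have hzero := fun v hv => mmult_eq_zero_of_parallel_edges hA hB hpar (v := v) hv
    ⟨finsum_mem_eq_zero_of_forall_eq_zero hzero, hzero⟩
  exact ⟨key h₁ h₂, key h₂ h₁⟩
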